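/- Let Ω be an exterior domain in ℝ^m with smooth internal boundary and v ∈ C^∞(Ω) with v(x) → ∞ as |x| → ∞. Then every smooth solution φ of the boundary value problem (−Δ + v(x))φ = λφ in Ω with smooth boundary data decays faster than any exponential: for every a > 0 there is C_a > 0 such that |φ(x)| ≤ C_a e^{−a|x|} for all x ∈ Ω. -/

import Mathlib

noncomputable section
open MeasureTheory Real Filter

/-- Partial derivative of `u` in the `i`-th coordinate direction. -/
def pd {Λ : Type*} [Fintype Λ] [DecidableEq Λ] (u : EuclideanSpace ℝ Λ → ℝ)
    (i : Λ) (x : EuclideanSpace ℝ Λ) : ℝ :=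
  fderiv ℝ u x (EuclideanSpace.single i 1)

/-- Laplacian of `u` (sum of second partial derivatives). -/
def lap {Λ : Type*} [Fintype Λ] [DecidableEq Λ] (u : EuclideanSpace ℝ Λ → ℝ)
    (x : EuclideanSpace ℝ Λ) : ℝ :=
  ∑ i, pd (pd u i) i x

/-- Hessian entry `∂_i ∂_j u (x)`. -/
def hess {Λ : Type*} [Fintype Λ] [DecidableEq Λ] (u : EuclideanSpace ℝ Λ → ℝ)
    (x : EuclideanSpace ℝ Λ) (i j : Λ) : ℝ :=
  pd (pd u j) i x

/-- The normalized Gibbs measure `Z⁻¹ e^{-Φ} dx`. -/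
def gibbs {Λ : Type*} [Fintype Λ] (Φ : EuclideanSpace ℝ Λ → ℝ) :
    Measure (EuclideanSpace ℝ Λ) :=
  (ENNReal.ofReal (∫ x, Real.exp (-Φ x)))⁻¹ •
    ((volume : Measure (EuclideanSpace ℝ Λ)).withDensity
      fun x => ENNReal.ofReal (Real.exp (-Φ x)))

section Calculus

variable {Λ : Type*} [Fintype Λ] [DecidableEq Λ] {u w : EuclideanSpace ℝ Λ → ℝ}

lemma contDiff_pd (hu : ContDiff ℝ 2 u) (i : Λ) : ContDiff ℝ 1 (pd u i) :=
  (hu.fderiv_right (m := 1) (by norm_num)).clm_apply contDiff_const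

lemma pd_sub (hu : Differentiable ℝ u) (hw : Differentiable ℝ w) (i : Λ) :
    pd (fun x => u x - w x) i = fun x => pd u i x - pd w i x := by
  funext x
  simp [pd, fderiv_fun_sub (hu x) (hw x)]

lemma lap_sub (hu : ContDiff ℝ 2 u) (hw : ContDiff ℝ 2 w) (x : EuclideanSpace ℝ Λ) :
    lap (fun x => u x - w x) x = lap u x - lap w x := by
  simp only [lap, pd_sub (hu.differentiable two_ne_zero) (hw.differentiable two_ne_zero),
    pd_sub ((contDiff_pd hu _).differentiable one_ne_zero)
      ((contDiff_pd hw _).differentiable one_ne_zero), Finset.sum_sub_distrib]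

lemma lap_neg (x : EuclideanSpace ℝ Λ) : lap (fun x => -u x) x = -lap u x := by
  have h : ∀ (f : EuclideanSpace ℝ Λ → ℝ) i, pd (fun x => -f x) i = fun x => -pd f i x := by
    intro f i
    funext x
    simp [pd, fderiv_fun_neg]
  simp [lap, h]

lemma lap_congr {x : EuclideanSpace ℝ Λ} (h : u =ᶠ[nhds x] w) : lap u x = lap w x := by
  refine Finset.sum_congr rfl fun i _ => ?_
  have h' : pd u i =ᶠ[nhds x] pd w i := by
    filter_upwards [h.eventuallyEq_nhds] with y hy
    simp only [pd, hy.fderiv_eq]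
  simp only [pd] at h' ⊢
  rw [Filter.EventuallyEq.fderiv_eq h']

lemma lap_sq (hu : ContDiff ℝ 2 u) (x : EuclideanSpace ℝ Λ) :
    lap (fun x => u x ^ 2) x = 2 * ∑ i, pd u i x ^ 2 + 2 * (u x * lap u x) := by
  have hd := hu.differentiable two_ne_zero
  have h1 : ∀ i, pd (fun x => u x ^ 2) i = fun x => 2 * (u x * pd u i x) := by
    intro i
    funext y
    have := ((hd y).hasFDerivAt.pow 2).fderiv
    simp only [pd]
    rw [this]
    simp
    ring
  have h2 : ∀ i, pd (fun x => 2 * (u x * pd u i x)) i x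
      = 2 * pd u i x ^ 2 + 2 * (u x * pd (pd u i) i x) := by
    intro i
    have hp := ((contDiff_pd hu i).differentiable one_ne_zero x).hasFDerivAt
    have := (((hd x).hasFDerivAt.mul hp).const_mul 2).fderiv
    conv_lhs => rw [pd]
    erw [this]
    simp [pd]
    ring
  simp only [lap, h1, h2, Finset.sum_add_distrib, Finset.mul_sum]

lemma hasDerivAt_comp_line (hu : Differentiable ℝ u) (i : Λ) (x : EuclideanSpace ℝ Λ) (t : ℝ) :
    HasDerivAt (fun t : ℝ => u (x + t • EuclideanSpace.single i (1 : ℝ)))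
      (pd u i (x + t • EuclideanSpace.single i (1 : ℝ))) t := by
  have h : HasDerivAt (fun t : ℝ => x + t • EuclideanSpace.single i (1 : ℝ))
      (EuclideanSpace.single i (1 : ℝ)) t := by
    simpa using ((hasDerivAt_id t).smul_const (EuclideanSpace.single i (1 : ℝ))).const_add x
  exact (hu _).hasFDerivAt.comp_hasDerivAt t h

lemma pd_pd_nonpos_of_isLocalMax (hu : ContDiff ℝ 2 u) {x : EuclideanSpace ℝ Λ}
    (hx : IsLocalMax u x) (i : Λ) : pd (pd u i) i x ≤ 0 := by
  have hud := hu.differentiable two_ne_zero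
  set h : ℝ → ℝ := fun t => u (x + t • EuclideanSpace.single i (1 : ℝ)) with hh
  have hd : deriv h = fun t => pd u i (x + t • EuclideanSpace.single i (1 : ℝ)) :=
    funext fun t => (hasDerivAt_comp_line hud i x t).deriv
  have hdd : deriv (deriv h) 0 = pd (pd u i) i x := by
    rw [hd]
    simpa using (hasDerivAt_comp_line ((contDiff_pd hu i).differentiable one_ne_zero) i x 0).deriv
  have hc : ContinuousAt h 0 := (hasDerivAt_comp_line hud i x 0).continuousAt
  have hmax : IsLocalMax h 0 := by
    have ht : Tendsto (fun t : ℝ => x + t • EuclideanSpace.single i (1 : ℝ)) (nhds 0) (nhds x) := by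
      have : Continuous (fun t : ℝ => x + t • EuclideanSpace.single i (1 : ℝ)) := by fun_prop
      simpa using this.tendsto 0
    have := ht.eventually hx
    simpa [IsLocalMax, IsMaxFilter, hh] using this
  by_contra! hpos
  have hmin := isLocalMin_of_deriv_deriv_pos (by rw [hdd]; exact hpos) hmax.deriv_eq_zero hc
  have hconst : h =ᶠ[nhds 0] fun _ => h 0 := by
    filter_upwards [hmax, hmin] with t h1 h2
    exact le_antisymm h1 h2
  have hz : deriv (deriv h) 0 = 0 := by
    rw [hconst.deriv.deriv_eq]
    simp
  linarith

lemma lap_nonpos_of_isLocalMax (hu : ContDiff ℝ 2 u) {x : EuclideanSpace ℝ Λ}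
    (hx : IsLocalMax u x) : lap u x ≤ 0 :=
  Finset.sum_nonpos fun i _ => pd_pd_nonpos_of_isLocalMax hu hx i

end Calculus

section Barrier

variable {Λ : Type*} [Fintype Λ]

/-- A smooth substitute for the exponential `e^{-a|x|}`. -/
def barrier (a : ℝ) (x : EuclideanSpace ℝ Λ) : ℝ := Real.exp (-a * √(1 + ‖x‖ ^ 2))

lemma barrier_pos (a : ℝ) (x : EuclideanSpace ℝ Λ) : 0 < barrier a x := Real.exp_pos _

lemma barrier_le {a : ℝ} (ha : 0 < a) (x : EuclideanSpace ℝ Λ) :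
    barrier a x ≤ Real.exp (-a * ‖x‖) := by
  refine Real.exp_le_exp.2 ?_
  have : ‖x‖ ≤ √(1 + ‖x‖ ^ 2) := Real.le_sqrt_of_sq_le (by linarith)
  nlinarith

lemma contDiff_sqrt_one_add_norm_sq :
    ContDiff ℝ 2 (fun x : EuclideanSpace ℝ Λ => √(1 + ‖x‖ ^ 2)) :=
  (contDiff_const.add (contDiff_norm_sq ℝ)).sqrt fun x => by positivity

lemma contDiff_barrier (a : ℝ) : ContDiff ℝ 2 (barrier (Λ := Λ) a) :=
  (contDiff_const.mul contDiff_sqrt_one_add_norm_sq).exp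

variable [DecidableEq Λ]

lemma pd_barrier (a : ℝ) (i : Λ) :
    pd (barrier a) i = fun x : EuclideanSpace ℝ Λ => -a * (x i / √(1 + ‖x‖ ^ 2)) * barrier a x := by
  funext x
  have hs : HasFDerivAt (fun x : EuclideanSpace ℝ Λ => 1 + ‖x‖ ^ 2) _ x :=
    (hasStrictFDerivAt_norm_sq x).hasFDerivAt.const_add 1
  have hq := ((hs.sqrt (by positivity)).const_mul (-a)).exp
  have : HasFDerivAt (barrier a) _ x := hq
  simp only [pd, this.fderiv]
  simp [barrier, EuclideanSpace.inner_single_right]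
  ring

lemma pd_pd_barrier_le {a : ℝ} (ha : 0 < a) (i : Λ) (x : EuclideanSpace ℝ Λ) :
    pd (pd (barrier a) i) i x ≤ (a ^ 2 + a) * barrier a x := by
  have hρ0 : √(1 + ‖x‖ ^ 2) ≠ 0 := by positivity
  have hs : HasFDerivAt (fun x : EuclideanSpace ℝ Λ => 1 + ‖x‖ ^ 2) _ x :=
    (hasStrictFDerivAt_norm_sq x).hasFDerivAt.const_add 1
  have hq := hs.sqrt (by positivity)
  have hi : HasFDerivAt (fun x : EuclideanSpace ℝ Λ => x i)
      (EuclideanSpace.proj i : EuclideanSpace ℝ Λ →L[ℝ] ℝ) x :=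
    (EuclideanSpace.proj i : EuclideanSpace ℝ Λ →L[ℝ] ℝ).hasFDerivAt
  have hb : HasFDerivAt (barrier a) _ x :=
    ((contDiff_barrier a).differentiable two_ne_zero x).hasFDerivAt
  have hbi : fderiv ℝ (barrier a) x (EuclideanSpace.single i 1)
      = -a * (x i / √(1 + ‖x‖ ^ 2)) * barrier a x := congrFun (pd_barrier a i) x
  have hqi := ((hi.mul ((hasDerivAt_inv hρ0).comp_hasFDerivAt x hq)).const_mul (-a)).mul hb
  have hfun : pd (barrier a) i = fun x : EuclideanSpace ℝ Λ =>
      -a * (x i * (√(1 + ‖x‖ ^ 2))⁻¹) * barrier a x := pd_barrier a i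
  have key : pd (pd (barrier a) i) i x = (a ^ 2 * (x i / √(1 + ‖x‖ ^ 2)) ^ 2
      + a * ((x i / √(1 + ‖x‖ ^ 2)) ^ 2 - 1) / √(1 + ‖x‖ ^ 2)) * barrier a x := by
    rw [hfun]
    conv_lhs => rw [pd]
    erw [hqi.fderiv]
    simp [EuclideanSpace.inner_single_right, hbi]
    field_simp
    ring
  rw [key]
  refine mul_le_mul_of_nonneg_right ?_ (barrier_pos a x).le
  have h1 : (x i / √(1 + ‖x‖ ^ 2)) ^ 2 ≤ 1 := by
    rw [div_pow, Real.sq_sqrt (by positivity), div_le_one (by positivity)]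
    have := PiLp.norm_apply_le x i
    rw [Real.norm_eq_abs] at this
    nlinarith [sq_abs (x i), abs_nonneg (x i)]
  have h2 : a * ((x i / √(1 + ‖x‖ ^ 2)) ^ 2 - 1) / √(1 + ‖x‖ ^ 2) ≤ 0 :=
    div_nonpos_of_nonpos_of_nonneg (by nlinarith) (by positivity)
  nlinarith [sq_nonneg a]

lemma lap_barrier_le {a : ℝ} (ha : 0 < a) (x : EuclideanSpace ℝ Λ) :
    lap (barrier a) x ≤ Fintype.card Λ * (a ^ 2 + a) * barrier a x := by
  refine (Finset.sum_le_sum fun i _ => pd_pd_barrier_le ha i x).trans ?_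
  simp [mul_assoc]

end Barrier

section MeanValue

variable {Λ : Type*} [Fintype Λ]

/-- A radial weight supported in the closed unit ball. -/
def bump (y : EuclideanSpace ℝ Λ) : ℝ := max (1 - ‖y‖ ^ 2) 0

lemma bump_nonneg (y : EuclideanSpace ℝ Λ) : 0 ≤ bump y := le_max_right _ _

lemma bump_le_one (y : EuclideanSpace ℝ Λ) : bump y ≤ 1 :=
  max_le (by nlinarith [sq_nonneg ‖y‖]) zero_le_one

lemma bump_eq_zero {y : EuclideanSpace ℝ Λ} (hy : 1 < ‖y‖) : bump y = 0 :=
  max_eq_right (by nlinarith)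

lemma continuous_bump : Continuous (bump (Λ := Λ)) := by
  unfold bump
  fun_prop

lemma hasCompactSupport_bump : HasCompactSupport (bump (Λ := Λ)) := by
  refine HasCompactSupport.intro (isCompact_closedBall 0 1) fun y hy => bump_eq_zero ?_
  simpa using hy

lemma integrable_mul_bump {f : EuclideanSpace ℝ Λ → ℝ} (hf : Continuous f) :
    Integrable (fun y => f y * bump y) :=
  (hf.mul continuous_bump).integrable_of_hasCompactSupport hasCompactSupport_bump.mul_left

lemma integral_bump_pos : 0 < ∫ y : EuclideanSpace ℝ Λ, bump y :=
  continuous_bump.integral_pos_of_hasCompactSupport_nonneg_nonzero hasCompactSupport_bump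
    bump_nonneg (x := 0) (by simp [bump])

lemma hasDerivAt_max_zero_sq (t : ℝ) :
    HasDerivAt (fun t : ℝ => max t 0 ^ 2) (2 * max t 0) t := by
  rcases lt_trichotomy t 0 with h | h | h
  · have : (fun t : ℝ => max t 0 ^ 2) =ᶠ[nhds t] fun _ => 0 := by
      filter_upwards [gt_mem_nhds h] with s hs
      simp [max_eq_right hs.le]
    rw [max_eq_right h.le, mul_zero]
    exact (hasDerivAt_const t 0).congr_of_eventuallyEq this
  · subst h
    have hO : (fun s : ℝ => max s 0 ^ 2) =O[nhds 0] fun s => s ^ 2 := by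
      refine Asymptotics.IsBigO.of_bound 1 (Eventually.of_forall fun s => ?_)
      simp only [norm_pow, Real.norm_eq_abs, one_mul]
      refine pow_le_pow_left₀ (abs_nonneg _) ?_ 2
      rw [abs_of_nonneg (le_max_right s 0)]
      exact max_le (le_abs_self s) (abs_nonneg s)
    have ho : (fun s : ℝ => s ^ 2) =o[nhds 0] fun s => s := by
      simpa using Asymptotics.isLittleO_pow_id (𝕜 := ℝ) one_lt_two
    rw [hasDerivAt_iff_isLittleO]
    simpa using hO.trans_isLittleO ho
  · have : (fun t : ℝ => max t 0 ^ 2) =ᶠ[nhds t] fun t => t ^ 2 := by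
      filter_upwards [lt_mem_nhds h] with s hs
      simp [max_eq_left hs.le]
    rw [max_eq_left h.le]
    simpa using (hasDerivAt_pow 2 t).congr_of_eventuallyEq this

lemma hasFDerivAt_bump_sq (y : EuclideanSpace ℝ Λ) :
    HasFDerivAt (fun y => bump y ^ 2) ((-4 * bump y) • innerSL ℝ y) y := by
  have hs : HasFDerivAt (fun y : EuclideanSpace ℝ Λ => 1 - ‖y‖ ^ 2) _ y :=
    (hasStrictFDerivAt_norm_sq y).hasFDerivAt.const_sub 1
  have := (hasDerivAt_max_zero_sq (1 - ‖y‖ ^ 2)).comp_hasFDerivAt y hs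
  refine this.congr_fderiv ?_
  ext z
  simp [bump]
  ring

variable {u : EuclideanSpace ℝ Λ → ℝ}

lemma hasDerivAt_integral_mul_bump (hu : ContDiff ℝ 2 u) (x : EuclideanSpace ℝ Λ) (s : ℝ) :
    HasDerivAt (fun s : ℝ => ∫ y, u (x + s • y) * bump y)
      (∫ y, fderiv ℝ u (x + s • y) y * bump y) s := by
  have hcu := hu.continuous
  have hcf := hu.continuous_fderiv two_ne_zero
  have hcF : Continuous fun p : ℝ × EuclideanSpace ℝ Λ => fderiv ℝ u (x + p.1 • p.2) p.2 :=
    (hcf.comp (by fun_prop)).clm_apply continuous_snd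
  obtain ⟨C, hC⟩ := ((isCompact_closedBall s 1).prod
    (isCompact_closedBall (0 : EuclideanSpace ℝ Λ) 1)).exists_bound_of_continuousOn hcF.continuousOn
  refine (hasDerivAt_integral_of_dominated_loc_of_deriv_le (s := Metric.closedBall s 1)
    (bound := fun y => C * bump y)
    (F := fun s y => u (x + s • y) * bump y)
    (F' := fun s y => fderiv ℝ u (x + s • y) y * bump y)
    (Metric.closedBall_mem_nhds s one_pos) ?_ ?_ ?_ ?_ ?_ ?_).2
  · exact Eventually.of_forall fun t =>
      (integrable_mul_bump (by fun_prop)).aestronglyMeasurable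
  · exact integrable_mul_bump (by fun_prop)
  · exact (integrable_mul_bump
      (hcF.comp (by fun_prop : Continuous fun y => (s, y)))).aestronglyMeasurable
  · refine Eventually.of_forall fun y t ht => ?_
    rcases le_or_gt ‖y‖ 1 with hy | hy
    · rw [norm_mul, Real.norm_of_nonneg (bump_nonneg y)]
      exact mul_le_mul_of_nonneg_right (hC (t, y) ⟨ht, by simpa using hy⟩) (bump_nonneg y)
    · simp [bump_eq_zero hy]
  · exact integrable_mul_bump continuous_const
  · refine Eventually.of_forall fun y t _ => ?_
    have h : HasDerivAt (fun t : ℝ => x + t • y) y t := by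
      simpa using ((hasDerivAt_id t).smul_const y).const_add x
    exact ((hu.differentiable two_ne_zero _).hasFDerivAt.comp_hasDerivAt t h).mul_const _

variable [DecidableEq Λ]

lemma fderiv_apply_eq_sum_pd (x y : EuclideanSpace ℝ Λ) :
    fderiv ℝ u x y = ∑ i, pd u i x * y i := by
  conv_lhs => rw [← (EuclideanSpace.basisFun Λ ℝ).sum_repr y]
  simp [pd, mul_comm]

lemma integral_pd_mul_bump (hu : ContDiff ℝ 2 u) (x : EuclideanSpace ℝ Λ) (s : ℝ) (i : Λ) :
    4 * ∫ y, pd u i (x + s • y) * y i * bump y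
      = ∫ y, s * pd (pd u i) i (x + s • y) * bump y ^ 2 := by
  have hp := contDiff_pd hu i
  have hpp : Continuous (pd (pd u i) i) :=
    (hp.continuous_fderiv one_ne_zero).clm_apply continuous_const
  have hcp := hp.continuous
  have hf : ∀ y, HasFDerivAt (fun y => pd u i (x + s • y))
      (s • fderiv ℝ (pd u i) (x + s • y)) y := by
    intro y
    have h : HasFDerivAt (fun y : EuclideanSpace ℝ Λ => x + s • y)
        (s • ContinuousLinearMap.id ℝ (EuclideanSpace ℝ Λ)) y :=
      ((hasFDerivAt_id y).const_smul s).const_add x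
    refine ((hp.differentiable one_ne_zero _).hasFDerivAt.comp y h).congr_fderiv ?_
    ext z
    simp
  have e1 : ∀ y, fderiv ℝ (fun y => pd u i (x + s • y)) y (EuclideanSpace.single i 1)
      = s * pd (pd u i) i (x + s • y) := fun y => by rw [(hf y).fderiv]; simp [pd]
  have e2 : ∀ y : EuclideanSpace ℝ Λ, fderiv ℝ (fun y => bump y ^ 2) y
      (EuclideanSpace.single i 1) = -4 * (y i * bump y) := fun y => by
    rw [(hasFDerivAt_bump_sq y).fderiv]
    simp [EuclideanSpace.inner_single_right]
    ring
  have hcb := continuous_bump (Λ := Λ)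
  have hparts := integral_mul_fderiv_eq_neg_fderiv_mul_of_integrable (μ := volume)
    (f := fun y => pd u i (x + s • y)) (g := fun y => bump y ^ 2)
    (v := EuclideanSpace.single i (1 : ℝ))
    (by
      simp_rw [e1, sq, ← mul_assoc]
      exact integrable_mul_bump (by fun_prop))
    (by
      simp_rw [e2, ← mul_assoc]
      exact integrable_mul_bump (by fun_prop))
    (by
      simp_rw [sq, ← mul_assoc]
      exact integrable_mul_bump (by fun_prop))
    (fun y _ => (hf y).differentiableAt) (fun y _ => (hasFDerivAt_bump_sq y).differentiableAt)
  simp_rw [e1, e2] at hparts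
  rw [← neg_eq_iff_eq_neg, ← integral_neg] at hparts
  rw [← hparts, ← integral_const_mul]
  congr 1
  funext y
  ring

lemma mul_integral_bump_le (hu : ContDiff ℝ 2 u) {x : EuclideanSpace ℝ Λ}
    (h : ∀ y ∈ Metric.closedBall x 1, 0 ≤ lap u y) :
    u x * ∫ y : EuclideanSpace ℝ Λ, bump y ≤ ∫ y, u (x + y) * bump y := by
  have hderiv : ∀ s ∈ Set.Icc (0 : ℝ) 1, 0 ≤ ∫ y, fderiv ℝ u (x + s • y) y * bump y := by
    intro s hs
    have hcp : ∀ i, Continuous (pd u i) := fun i => (contDiff_pd hu i).continuous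
    have hpp : ∀ i, Continuous (pd (pd u i) i) := fun i =>
      ((contDiff_pd hu i).continuous_fderiv one_ne_zero).clm_apply continuous_const
    have hcb := continuous_bump (Λ := Λ)
    have e : 4 * ∫ y, fderiv ℝ u (x + s • y) y * bump y
        = ∫ y, s * lap u (x + s • y) * bump y ^ 2 := by
      simp_rw [fderiv_apply_eq_sum_pd, lap, Finset.sum_mul, Finset.mul_sum, Finset.sum_mul]
      rw [integral_finsetSum, integral_finsetSum, Finset.mul_sum]
      · exact Finset.sum_congr rfl fun i _ => integral_pd_mul_bump hu x s i
      · intro i _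
        have := hpp i
        simp_rw [sq, ← mul_assoc]
        exact integrable_mul_bump (by fun_prop)
      · intro i _
        have := hcp i
        exact integrable_mul_bump (by fun_prop)
    have : 0 ≤ ∫ y, s * lap u (x + s • y) * bump y ^ 2 := by
      refine integral_nonneg fun y => ?_
      rcases le_or_gt ‖y‖ 1 with hy | hy
      · refine mul_nonneg (mul_nonneg hs.1 (h _ ?_)) (sq_nonneg _)
        rw [mem_closedBall_iff_norm, add_sub_cancel_left, norm_smul, Real.norm_of_nonneg hs.1]
        nlinarith [hs.2, norm_nonneg y]
      · simp [bump_eq_zero hy]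
    linarith
  have hmono : MonotoneOn (fun s : ℝ => ∫ y, u (x + s • y) * bump y) (Set.Icc 0 1) := by
    refine monotoneOn_of_deriv_nonneg (convex_Icc 0 1)
      (fun s _ => (hasDerivAt_integral_mul_bump hu x s).continuousAt.continuousWithinAt)
      (fun s _ => (hasDerivAt_integral_mul_bump hu x s).differentiableAt.differentiableWithinAt)
      fun s hs => ?_
    rw [(hasDerivAt_integral_mul_bump hu x s).deriv]
    exact hderiv s (interior_subset hs)
  have := hmono (Set.left_mem_Icc.2 zero_le_one) (Set.right_mem_Icc.2 zero_le_one) zero_le_one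
  simpa [integral_const_mul] using this

end MeanValue

section Exterior

variable {Λ : Type*} [Fintype Λ] [DecidableEq Λ] {φ q : EuclideanSpace ℝ Λ → ℝ} {R : ℝ}

lemma tendsto_zero_of_lap_eq (hφ : ContDiff ℝ 2 φ)
    (heq : ∀ x, R < ‖x‖ → lap φ x = q x * φ x) (hq : ∀ x, R < ‖x‖ → 0 ≤ q x)
    (hL2int : IntegrableOn (fun x => φ x ^ 2) {x | R < ‖x‖}) :
    Tendsto φ (cocompact (EuclideanSpace ℝ Λ)) (nhds 0) := by
  set c : ℝ := ∫ y : EuclideanSpace ℝ Λ, bump y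
  have hc0 : 0 < c := integral_bump_pos
  set T : ℕ → ℝ := fun n => ∫ y in {y : EuclideanSpace ℝ Λ | (n : ℝ) < ‖y‖}, φ y ^ 2 with hT
  have hmeas : ∀ r : ℝ, MeasurableSet {y : EuclideanSpace ℝ Λ | r < ‖y‖} := fun r =>
    (isOpen_lt continuous_const continuous_norm).measurableSet
  have hTlim : Tendsto T atTop (nhds 0) := by
    have := tendsto_setIntegral_of_antitone (μ := volume) (f := fun y => φ y ^ 2)
      (s := fun n : ℕ => {y : EuclideanSpace ℝ Λ | (n : ℝ) < ‖y‖}) (fun n => hmeas n)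
      (fun m n hmn y (hy : (n : ℝ) < ‖y‖) =>
        show (m : ℝ) < ‖y‖ from (Nat.cast_le.2 hmn).trans_lt hy)
      (by
        obtain ⟨n, hn⟩ := exists_nat_ge R
        exact ⟨n, hL2int.mono_set fun y hy => hn.trans_lt hy⟩)
    have he : ⋂ n : ℕ, {y : EuclideanSpace ℝ Λ | (n : ℝ) < ‖y‖} = ∅ := by
      refine Set.eq_empty_of_forall_notMem fun y hy => ?_
      obtain ⟨n, hn⟩ := exists_nat_ge ‖y‖
      exact (Set.mem_iInter.1 hy n).not_ge hn
    simpa [he] using this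
  have hbound : ∀ (n : ℕ) (x : EuclideanSpace ℝ Λ), R ≤ n → (n : ℝ) + 1 < ‖x‖ →
      φ x ^ 2 * c ≤ T n := by
    intro n x hn hx
    have hball : ∀ y ∈ Metric.closedBall x 1, (n : ℝ) < ‖y‖ := by
      intro y hy
      rw [mem_closedBall_iff_norm'] at hy
      linarith [norm_sub_norm_le x y]
    refine (mul_integral_bump_le (u := fun x => φ x ^ 2) (hφ.pow 2) fun y hy => ?_).trans ?_
    · have hy' := hn.trans_lt (hball y hy)
      rw [lap_sq hφ, heq y hy']
      have := Finset.sum_nonneg fun i (_ : i ∈ Finset.univ) => sq_nonneg (pd φ i y)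
      nlinarith [mul_nonneg (hq y hy') (sq_nonneg (φ y))]
    · have hcφ := hφ.continuous
      have hshift : ∫ y, φ (x + y) ^ 2 * bump y = ∫ y, φ y ^ 2 * bump (y - x) := by
        simpa using integral_add_left_eq_self (μ := volume) (fun y => φ y ^ 2 * bump (y - x)) x
      have hintb : Integrable fun y => φ y ^ 2 * bump (y - x) := by
        have h := (integrable_mul_bump (f := fun y => φ (x + y) ^ 2) (by fun_prop)).comp_sub_right x
        simpa using h
      rw [hshift, hT]
      simp only
      rw [← integral_indicator (hmeas n)]
      refine integral_mono hintb
        ((hL2int.mono_set fun y hy => hn.trans_lt hy).integrable_indicator (hmeas n)) fun y => ?_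
      by_cases hy : y ∈ Metric.closedBall x 1
      · rw [Set.indicator_of_mem (show y ∈ {y | (n : ℝ) < ‖y‖} from hball y hy)]
        exact mul_le_of_le_one_right (sq_nonneg _) (bump_le_one _)
      · have : bump (y - x) = 0 := bump_eq_zero (by
          rwa [mem_closedBall_iff_norm, not_le] at hy)
        simp only [this, mul_zero]
        exact Set.indicator_nonneg (fun _ _ => sq_nonneg _) _
  rw [Metric.tendsto_nhds]
  intro ε hε
  obtain ⟨N, hN⟩ := exists_nat_ge R
  obtain ⟨n, hnT, hnN⟩ := ((hTlim.eventually (gt_mem_nhds (show 0 < ε ^ 2 * c by positivity))).and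
    (eventually_ge_atTop N)).exists
  filter_upwards [(tendsto_norm_cocompact_atTop (E := EuclideanSpace ℝ Λ)).eventually_gt_atTop
    ((n : ℝ) + 1)] with x hx
  have h := (hbound n x (hN.trans (Nat.cast_le.2 hnN)) hx).trans_lt hnT
  rw [dist_zero_right, Real.norm_eq_abs]
  exact abs_lt_of_sq_lt_sq (lt_of_mul_lt_mul_right h hc0.le) hε.le

lemma le_barrier_of_lap_eq {a M : ℝ} (ha : 0 < a) (hM : 0 < M) (hφ : ContDiff ℝ 2 φ)
    (hlim : Tendsto φ (cocompact (EuclideanSpace ℝ Λ)) (nhds 0))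
    (heq : ∀ x, R < ‖x‖ → lap φ x = q x * φ x)
    (hq : ∀ x, R < ‖x‖ → Fintype.card Λ * (a ^ 2 + a) + 1 ≤ q x)
    (hbdry : ∀ x, ‖x‖ = R → φ x ≤ M * barrier a x) :
    ∀ x, R ≤ ‖x‖ → φ x ≤ M * barrier a x := by
  by_contra! hcon
  obtain ⟨x₀, hx₀, hlt⟩ := hcon
  have hb : ContDiff ℝ 2 (fun x : EuclideanSpace ℝ Λ => M * barrier a x) :=
    contDiff_const.mul (contDiff_barrier a)
  set g : EuclideanSpace ℝ Λ → ℝ := fun x => φ x - M * barrier a x with hg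
  have hgd : ContDiff ℝ 2 g := hφ.sub hb
  have hg0 : 0 < g x₀ := sub_pos.2 hlt
  obtain ⟨x, hx, hmax⟩ := hgd.continuous.continuousOn.exists_isMaxOn'
    (isClosed_le continuous_const continuous_norm : IsClosed {x : EuclideanSpace ℝ Λ | R ≤ ‖x‖})
    hx₀ (by
      refine Filter.Eventually.filter_mono inf_le_left ?_
      filter_upwards [hlim.eventually (gt_mem_nhds hg0)] with y hy
      have := mul_pos hM (barrier_pos a y)
      simp only [hg] at hy ⊢
      linarith)
  have hgx : 0 < g x := hg0.trans_le (hmax hx₀)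
  have hRx : R < ‖x‖ := lt_of_le_of_ne hx fun h => by
    have := hbdry x h.symm
    simp only [hg] at hgx
    linarith
  have hloc : IsLocalMax g x := hmax.isLocalMax
    (mem_of_superset ((isOpen_lt continuous_const continuous_norm).mem_nhds hRx)
      fun y (hy : R < ‖y‖) => hy.le)
  have hlap := lap_nonpos_of_isLocalMax hgd hloc
  have hcmul : lap (fun x : EuclideanSpace ℝ Λ => M * barrier a x) x = M * lap (barrier a) x := by
    have hpd : ∀ (f : EuclideanSpace ℝ Λ → ℝ) i,
        pd (fun x => M * f x) i = fun x => M * pd f i x := by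
      intro f i
      funext y
      have h : (fun x => M * f x) = M • f := rfl
      simp [pd, h, fderiv_const_smul_field]
    simp only [lap, hpd, Finset.mul_sum]
  rw [lap_sub hφ hb, hcmul, heq x hRx] at hlap
  have h1 := mul_le_mul_of_nonneg_left (lap_barrier_le ha x) hM.le
  have h2 := mul_pos hM (barrier_pos a x)
  have hgx' : M * barrier a x < φ x := sub_pos.1 hgx
  have h3 := mul_le_mul_of_nonneg_right (hq x hRx) (h2.trans hgx').le
  have h4 : (0 : ℝ) ≤ Fintype.card Λ * (a ^ 2 + a) := by positivity
  nlinarith [mul_le_mul_of_nonneg_left hgx'.le h4]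

end Exterior

/-- Multiplying by a cutoff extends a function smooth off `{‖x‖ < R}` to the whole space. -/
lemma exists_contDiff_eq_of_lt_norm {E : Type*} [NormedAddCommGroup E] [InnerProductSpace ℝ E]
    {Ω : Set E} (hΩ : IsOpen Ω) {f : E → ℝ} (hf : ContDiffOn ℝ (⊤ : ℕ∞) f Ω) {R : ℝ} (hR : 0 < R)
    (hΩR : ∀ x, R ≤ ‖x‖ → x ∈ Ω) :
    ∃ g : E → ℝ, ContDiff ℝ 2 g ∧ ∀ x, R + 1 ≤ ‖x‖ → g x = f x := by
  refine ⟨fun x => Real.smoothTransition (‖x‖ ^ 2 - R ^ 2) * f x, ?_, fun x hx => ?_⟩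
  · refine contDiff_iff_contDiffAt.2 fun x => ?_
    rcases lt_or_ge ‖x‖ R with hx | hx
    · have : (fun x => Real.smoothTransition (‖x‖ ^ 2 - R ^ 2) * f x) =ᶠ[nhds x] fun _ => 0 := by
        filter_upwards [(isOpen_lt continuous_norm continuous_const).mem_nhds hx] with y hy
        have hy' : ‖y‖ < R := hy
        rw [Real.smoothTransition.zero_of_nonpos (by nlinarith [norm_nonneg y]), zero_mul]
      exact contDiffAt_const.congr_of_eventuallyEq this
    · have h1 : ContDiffAt ℝ 2 f x :=
        (hf.contDiffAt (hΩ.mem_nhds (hΩR x hx))).of_le (WithTop.coe_le_coe.2 le_top)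
      have h2 : ContDiff ℝ 2 fun x : E => Real.smoothTransition (‖x‖ ^ 2 - R ^ 2) :=
        Real.smoothTransition.contDiff.comp ((contDiff_norm_sq ℝ).sub contDiff_const)
      exact h2.contDiffAt.mul h1
  · simp only
    rw [Real.smoothTransition.one_of_one_le (by nlinarith), one_mul]

/-- Let `Ω ⊂ ℝ^m` be an exterior domain and `v ∈ C^∞(Ω)` with
`v(x) → ∞` as `|x| → ∞`.  Then every smooth (square-integrable) solution `φ` of
`(−Δ + v)φ = λφ` in `Ω`, continuous up to the boundary, decays faster than any
exponential: for every `a > 0` there is `C_a > 0` with `|φ(x)| ≤ C_a e^{−a|x|}` on `Ω`. -/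
theorem superexponential_decay_eigenfunctions
    {Λ : Type*} [Fintype Λ] [DecidableEq Λ]
    (Ω : Set (EuclideanSpace ℝ Λ)) (hΩo : IsOpen Ω) (hΩc : IsConnected Ω)
    (hΩext : IsCompact Ωᶜ)
    (v : EuclideanSpace ℝ Λ → ℝ) (hv : ContDiffOn ℝ (⊤ : ℕ∞) v Ω)
    (hvinfty : ∀ A : ℝ, ∀ᶠ x in cocompact (EuclideanSpace ℝ Λ), A ≤ v x)
    (lam : ℝ)
    (φ : EuclideanSpace ℝ Λ → ℝ)
    (hφ : ContDiffOn ℝ (⊤ : ℕ∞) φ Ω) (hφc : ContinuousOn φ (closure Ω))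
    (hφL2 : IntegrableOn (fun x => (φ x) ^ 2) Ω volume)
    (heq : ∀ x ∈ Ω, -lap φ x + v x * φ x = lam * φ x) :
    ∀ a : ℝ, 0 < a → ∃ C : ℝ, 0 < C ∧ ∀ x ∈ Ω,
      |φ x| ≤ C * Real.exp (-a * ‖x‖) := by
  intro a ha
  have hev := (hvinfty (lam + (Fintype.card Λ * (a ^ 2 + a) + 1))).and
    hΩext.compl_mem_cocompact
  obtain ⟨R₀, hR₀⟩ := Metric.closedBall_compl_subset_of_mem_cocompact hev 0
  set R := max R₀ 0 + 1
  have hRpos : 0 < R := by positivity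
  have hfar : ∀ x : EuclideanSpace ℝ Λ, R ≤ ‖x‖ →
      lam + (Fintype.card Λ * (a ^ 2 + a) + 1) ≤ v x ∧ x ∈ Ω := by
    intro x hx
    have := hR₀ (show x ∈ (Metric.closedBall 0 R₀)ᶜ by
      simp only [Set.mem_compl_iff, mem_closedBall_zero_iff, not_le]
      linarith [le_max_left R₀ 0])
    simpa using this
  obtain ⟨g, hg, hgφ⟩ := exists_contDiff_eq_of_lt_norm hΩo hφ hRpos fun x hx => (hfar x hx).2
  have hlap : ∀ x, R + 1 < ‖x‖ → lap g x = (v x - lam) * g x := by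
    intro x hx
    have he : g =ᶠ[nhds x] φ := by
      filter_upwards [(isOpen_lt continuous_const continuous_norm).mem_nhds hx] with y hy
      exact hgφ y (le_of_lt hy)
    rw [lap_congr he, hgφ x hx.le]
    linarith [heq x (hfar x (by linarith)).2]
  have hq : ∀ x : EuclideanSpace ℝ Λ, R + 1 < ‖x‖ →
      Fintype.card Λ * (a ^ 2 + a) + 1 ≤ v x - lam := fun x hx => by
    linarith [(hfar x (by linarith)).1]
  have hmeas : MeasurableSet {x : EuclideanSpace ℝ Λ | R + 1 < ‖x‖} :=
    (isOpen_lt continuous_const continuous_norm).measurableSet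
  have hL2int : IntegrableOn (fun x => g x ^ 2) {x | R + 1 < ‖x‖} := by
    refine (hφL2.mono_set fun x (hx : R + 1 < ‖x‖) =>
      (hfar x (by linarith)).2).congr_fun (fun x (hx : R + 1 < ‖x‖) => ?_) hmeas
    simp only [hgφ x hx.le]
  have hlim := tendsto_zero_of_lap_eq hg hlap
    (fun x hx => le_trans (by positivity) (hq x hx)) hL2int
  obtain ⟨K, hK⟩ := (isCompact_closedBall (0 : EuclideanSpace ℝ Λ)
    (R + 1)).exists_bound_of_continuousOn hg.continuous.continuousOn
  obtain ⟨L, hL⟩ := ((isCompact_closedBall (0 : EuclideanSpace ℝ Λ) (R + 1)).inter_left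
    (isClosed_closure (s := Ω))).exists_bound_of_continuousOn (hφc.mono Set.inter_subset_left)
  have hinner : ∀ {B b t s : ℝ}, |b| ≤ B → s ≤ t →
      |b| ≤ (|B| + 1) * Real.exp (a * t) * Real.exp (-a * s) := by
    intro B b t s hb hst
    rw [mul_assoc, ← Real.exp_add]
    have : 1 ≤ Real.exp (a * t + -a * s) := Real.one_le_exp (by nlinarith)
    nlinarith [le_abs_self B, abs_nonneg B]
  set ρ := √(1 + (R + 1) ^ 2)
  set M := (|K| + 1) * Real.exp (a * ρ)
  have hM : 0 < M := by positivity
  have hbdry : ∀ x : EuclideanSpace ℝ Λ, ‖x‖ = R + 1 → |g x| ≤ M * barrier a x := by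
    intro x hx
    have := hinner (t := ρ) (s := ρ) (hK x (by simp [hx])) le_rfl
    simpa [barrier, hx] using this
  have hup := le_barrier_of_lap_eq ha hM hg hlim hlap hq
    fun x hx => (le_abs_self _).trans (hbdry x hx)
  have hdown := le_barrier_of_lap_eq (φ := fun x => -g x) ha hM hg.neg (by simpa using hlim.neg)
    (fun x hx => by rw [lap_neg, hlap x hx]; ring) hq
    fun x hx => (neg_le_abs _).trans (hbdry x hx)
  refine ⟨max M ((|L| + 1) * Real.exp (a * (R + 1))), lt_max_of_lt_left hM, fun x hx => ?_⟩
  rcases le_total ‖x‖ (R + 1) with hxR | hxR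
  · refine (hinner (hL x ⟨subset_closure hx, by simpa using hxR⟩) hxR).trans ?_
    exact mul_le_mul_of_nonneg_right (le_max_right _ _) (Real.exp_pos _).le
  · rw [← hgφ x hxR]
    calc |g x| ≤ M * barrier a x := abs_le.2 ⟨by linarith [hdown x hxR], hup x hxR⟩
      _ ≤ M * Real.exp (-a * ‖x‖) := mul_le_mul_of_nonneg_left (barrier_le ha x) hM.le
      _ ≤ _ := mul_le_mul_of_nonneg_right (le_max_left _ _) (Real.exp_pos _).le
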